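/- arXiv:2008.08641 — 2 statements merged into one kernel-verified Lean document; each statement's English description precedes it below -/
import Mathlib

section
/- Let a ≠ b be real numbers, let I be the open interval between a and b, and let j = sign(b−a). Let Ω be three times continuously differentiable, monotonic and strictly positive on an open interval containing [min(a,b), max(a,b)] with Ω(b) > Ω(a), and let Y be a twice differentiable, not identically zero solution of Y''(z) + Ω(z)Y(z) = 0 on that open interval, with Y(a) = 0 and Y(z) ≠ 0 for all z ∈ I. Let z⁰ ∈ I ∪ {b} and define z^{i+1} = T_j(z^i); assume z^i ≠ a for all i. Then the iteration converges to a with order of convergence 4 and asymptotic error constant Ω'(a)/12, i.e. lim_{i→∞} (z^{i+1} − a)/(z^i − a)^4 = Ω'(a)/12. -/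
open Real Filter Set

/-- The modified arctangent function `arctan_j`. -/
noncomputable def arctanJ (j ζ : ℝ) : ℝ :=
  if j * ζ > 0 then Real.arctan ζ else Real.arctan ζ + j * Real.pi

/-- The fixed point map `T_j` associated with `Y'' + Ω Y = 0`. -/
noncomputable def Tmap (Ω Y : ℝ → ℝ) (j : ℝ) (z : ℝ) : ℝ :=
  if deriv Y z = 0 then z - j * Real.pi / (2 * Real.sqrt (Ω z))
  else z - (1 / Real.sqrt (Ω z)) * arctanJ j (Real.sqrt (Ω z) * Y z / deriv Y z)

/-- Difference quotients along two sequences tending to a point of strict differentiability. -/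
theorem HasStrictDerivAt.tendsto_div_sub {f : ℝ → ℝ} {f' a : ℝ} (hf : HasStrictDerivAt f f' a)
    {u v : ℕ → ℝ} (hu : Tendsto u atTop (nhds a)) (hv : Tendsto v atTop (nhds a))
    (huv : ∀ i, u i ≠ v i) :
    Tendsto (fun i => (f (u i) - f (v i)) / (u i - v i)) atTop (nhds f') := by
  have h := (hf.isLittleO.comp_tendsto (hu.prodMk_nhds hv)).tendsto_div_nhds_zero
  have h2 := h.add_const f'
  rw [zero_add] at h2
  refine h2.congr fun i => ?_
  have : u i - v i ≠ 0 := sub_ne_zero.2 (huv i)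
  simp only [Function.comp, ContinuousLinearMap.toSpanSingleton_apply, smul_eq_mul]
  field_simp
  ring

theorem Real.mul_sinc (x : ℝ) : x * Real.sinc x = Real.sin x := by
  rcases eq_or_ne x 0 with rfl | hx
  · simp
  · rw [Real.sinc_of_ne_zero hx]
    field_simp

/-- The Wronskian of `Y` and `sin (w * (x - a))`. -/
noncomputable def sineWronskian (Y Y' : ℝ → ℝ) (a w x : ℝ) : ℝ :=
  Y x * (w * Real.cos (w * (x - a))) - Y' x * Real.sin (w * (x - a))

theorem sineWronskian_left {Y : ℝ → ℝ} {a : ℝ} (hYa : Y a = 0) (Y' : ℝ → ℝ) (w : ℝ) :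
    sineWronskian Y Y' a w a = 0 := by
  simp [sineWronskian, hYa]

theorem hasDerivAt_sineWronskian {Ω Y Y' : ℝ → ℝ} {x : ℝ} (hY : HasDerivAt Y (Y' x) x)
    (hY' : HasDerivAt Y' (-(Ω x * Y x)) x) (a w : ℝ) :
    HasDerivAt (sineWronskian Y Y' a w)
      (Y x * Real.sin (w * (x - a)) * (Ω x - w ^ 2)) x := by
  have hl : HasDerivAt (fun x => w * (x - a)) w x := by
    simpa using ((hasDerivAt_id x).sub_const a).const_mul w
  have h := (hY.mul (hl.cos.const_mul w)).sub (hY'.mul hl.sin)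
  refine h.congr_deriv ?_
  ring

/-- If `t` is the phase of `(w * Y, Y')` at `z`, the Wronskian measures the distance from `a` to the
zero `z - t / w` of the matched sine wave. -/
theorem sineWronskian_eq_of_phase {Y Y' : ℝ → ℝ} {a w z t : ℝ} (hw : w ≠ 0)
    (ht : w * Y z * Real.cos t = Y' z * Real.sin t) :
    sineWronskian Y Y' a w z =
      -((w * Y z * Real.sin t + Y' z * Real.cos t) * Real.sin (w * (z - t / w - a))) := by
  have h1 : w * (z - t / w - a) = w * (z - a) - t := by field_simp; ring
  rw [h1, Real.sin_sub, sineWronskian]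
  have h2 := Real.sin_sq_add_cos_sq t
  linear_combination (w * Y z * Real.cos (w * (z - a)) - Y' z * Real.sin (w * (z - a))) * (-h2)
    + (Real.cos (w * (z - a)) * Real.cos t + Real.sin t * Real.sin (w * (z - a))) * ht

/-- One step of the iteration: it moves to the left but not beyond the zero `a`. -/
theorem le_sub_phase_div {Ω Y Y' : ℝ → ℝ} {a z t : ℝ} (haz : a < z)
    (hΩmono : MonotoneOn Ω (Icc a z)) (hΩpos : ∀ x ∈ Icc a z, 0 < Ω x)
    (hY : ∀ x ∈ Icc a z, HasDerivAt Y (Y' x) x)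
    (hY' : ∀ x ∈ Icc a z, HasDerivAt Y' (-(Ω x * Y x)) x)
    (hYa : Y a = 0) (hYpos : ∀ x ∈ Ioo a z, 0 < Y x)
    (htpi : t ≤ π)
    (ht : √(Ω z) * Y z * Real.cos t = Y' z * Real.sin t)
    (hR : 0 < √(Ω z) * Y z * Real.sin t + Y' z * Real.cos t) :
    a ≤ z - t / √(Ω z) := by
  by_contra! hlt
  have hw : 0 < √(Ω z) := Real.sqrt_pos.2 (hΩpos z ⟨haz.le, le_rfl⟩)
  have hw2 : √(Ω z) ^ 2 = Ω z := Real.sq_sqrt (hΩpos z ⟨haz.le, le_rfl⟩).le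
  set w := √(Ω z) with hwdef
  have hwt : w * (z - a) < t := by
    have : z - a < t / w := by linarith
    rwa [lt_div_iff₀ hw, mul_comm] at this
  have hanti : AntitoneOn (sineWronskian Y Y' a w) (Icc a z) := by
    refine antitoneOn_of_hasDerivWithinAt_nonpos (convex_Icc a z)
      (fun x hx => (hasDerivAt_sineWronskian (hY x hx) (hY' x hx) a w).continuousAt.continuousWithinAt)
      (f' := fun x => Y x * Real.sin (w * (x - a)) * (Ω x - w ^ 2))
      (fun x hx => ?_) (fun x hx => ?_)
    · rw [interior_Icc] at hx
      have hx' := Ioo_subset_Icc_self hx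
      exact (hasDerivAt_sineWronskian (hY x hx') (hY' x hx') a w).hasDerivWithinAt
    · rw [interior_Icc] at hx
      have hx' := Ioo_subset_Icc_self hx
      have h1 : 0 ≤ Real.sin (w * (x - a)) := by
        refine Real.sin_nonneg_of_nonneg_of_le_pi
          (mul_nonneg hw.le (sub_nonneg.2 hx.1.le)) ?_
        have : w * (x - a) ≤ w * (z - a) :=
          mul_le_mul_of_nonneg_left (by linarith [hx.2]) hw.le
        linarith
      have h2 : Ω x ≤ Ω z := hΩmono hx' ⟨haz.le, le_rfl⟩ hx.2.le
      exact mul_nonpos_of_nonneg_of_nonpos (mul_nonneg (hYpos x hx).le h1) (by linarith)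
  have hV := hanti ⟨le_rfl, haz.le⟩ ⟨haz.le, le_rfl⟩ haz.le
  rw [sineWronskian_left hYa, sineWronskian_eq_of_phase hw.ne' ht] at hV
  have h1 : w * (z - t / w - a) = -(t - w * (z - a)) := by field_simp; ring
  rw [h1, Real.sin_neg] at hV
  have h2 : 0 < Real.sin (t - w * (z - a)) :=
    Real.sin_pos_of_pos_of_lt_pi (by linarith) (by nlinarith)
  nlinarith [mul_pos hR h2]

/-- Expansion of the Wronskian, via Cauchy's mean value theorem. -/
theorem exists_sineWronskian_eq {Ω Y Y' : ℝ → ℝ} {a z : ℝ} (haz : a < z) (hΩz : 0 ≤ Ω z)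
    (hY : ∀ x ∈ Icc a z, HasDerivAt Y (Y' x) x)
    (hY' : ∀ x ∈ Icc a z, HasDerivAt Y' (-(Ω x * Y x)) x) (hYa : Y a = 0) :
    ∃ c ∈ Ioo a z, -sineWronskian Y Y' a √(Ω z) z / (z - a) ^ 4 =
      (Y c - Y a) / (c - a) * (√(Ω z) * Real.sinc (√(Ω z) * (c - a))) *
        ((Ω z - Ω c) / (z - c)) / 12 := by
  have hG : ∀ x, HasDerivAt (fun x => (z - a) * (x - a) ^ 3 / 3 - (x - a) ^ 4 / 4)
      ((x - a) ^ 2 * (z - x)) x := by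
    intro x
    have hl := (hasDerivAt_id x).sub_const a
    have h := (((hl.pow 3).const_mul (z - a)).div_const 3).sub ((hl.pow 4).div_const 4)
    refine h.congr_deriv ?_
    simp
    ring
  have hV : ∀ x ∈ Icc a z, HasDerivAt (sineWronskian Y Y' a √(Ω z))
      (Y x * Real.sin (√(Ω z) * (x - a)) * (Ω x - √(Ω z) ^ 2)) x :=
    fun x hx => hasDerivAt_sineWronskian (hY x hx) (hY' x hx) a _
  obtain ⟨c, hc, h⟩ := exists_ratio_hasDerivAt_eq_ratio_slope _ _ haz
    (fun x hx => (hV x hx).continuousAt.continuousWithinAt)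
    (fun x hx => hV x (Ioo_subset_Icc_self hx)) _ _
    (fun x _ => (hG x).continuousAt.continuousWithinAt) (fun x _ => hG x)
  refine ⟨c, hc, ?_⟩
  have h1 : c - a ≠ 0 := by linarith [hc.1]
  have h2 : z - c ≠ 0 := by linarith [hc.2]
  have h3 : z - a ≠ 0 := by linarith
  rw [sineWronskian_left hYa, Real.sq_sqrt hΩz, ← Real.mul_sinc] at h
  rw [hYa]
  generalize Real.sinc _ = S at h ⊢
  field_simp
  apply mul_right_cancel₀ h1
  linear_combination 12 * h

/-- Convergence and order of the iteration, for `a < b` and `Y > 0` on `(a, b)`, with `Tmap`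
described by the phase `t i` of `(√Ω * Y, Y')`. -/
theorem tendsto_phase_iteration {Ω Y Y' : ℝ → ℝ} {a b Ω' : ℝ} (hab : a < b)
    (hΩ' : HasStrictDerivAt Ω Ω' a) (hΩcont : ContinuousOn Ω (Icc a b))
    (hΩmono : MonotoneOn Ω (Icc a b)) (hΩpos : ∀ x ∈ Icc a b, 0 < Ω x)
    (hY : ∀ x ∈ Icc a b, HasDerivAt Y (Y' x) x)
    (hY' : ∀ x ∈ Icc a b, HasDerivAt Y' (-(Ω x * Y x)) x)
    (hYa : Y a = 0) (hYpos : ∀ x ∈ Ioo a b, 0 < Y x)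
    {z t : ℕ → ℝ} (hz0 : z 0 ∈ Ioc a b) (hz : ∀ i, z (i + 1) = z i - t i / √(Ω (z i)))
    (ht0 : ∀ i, 0 < t i) (htpi : ∀ i, t i ≤ π)
    (ht : ∀ i, √(Ω (z i)) * Y (z i) * Real.cos (t i) = Y' (z i) * Real.sin (t i))
    (hne : ∀ i, z i ≠ a) :
    Tendsto (fun i => (z (i + 1) - a) / (z i - a) ^ 4) atTop (nhds (Ω' / 12)) := by
  have hYcont : ContinuousOn Y (Icc a b) := fun x hx => (hY x hx).continuousAt.continuousWithinAt
  have hY'cont : ContinuousOn Y' (Icc a b) :=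
    fun x hx => (hY' x hx).continuousAt.continuousWithinAt
  have haI : a ∈ Icc a b := ⟨le_rfl, hab.le⟩
  have hbI : b ∈ Icc a b := ⟨hab.le, le_rfl⟩
  have hanti : StrictAntiOn Y' (Icc a b) := by
    refine strictAntiOn_of_deriv_neg (convex_Icc a b) hY'cont fun x hx => ?_
    rw [interior_Icc] at hx
    have hx' := Ioo_subset_Icc_self hx
    rw [(hY' x hx').deriv]
    linarith [mul_pos (hΩpos x hx') (hYpos x hx)]
  have hYb : 0 ≤ Y b := by
    have hcl : b ∈ closure (Ioo a b) := by rw [closure_Ioo hab.ne]; exact hbI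
    exact closure_minimal (t := {y : ℝ | 0 ≤ y}) (by rintro _ ⟨x, hx, rfl⟩; exact (hYpos x hx).le)
      isClosed_Ici ((hYcont b hbI).mono Ioo_subset_Icc_self |>.mem_closure_image hcl)
  have hY'a : 0 < Y' a := by
    obtain ⟨c, hc, h⟩ := exists_hasDerivAt_eq_slope Y Y' hab hYcont
      (fun x hx => hY x (Ioo_subset_Icc_self hx))
    have h1 : 0 ≤ Y' c := by
      rw [h, hYa]
      exact div_nonneg (by linarith) (by linarith)
    linarith [hanti haI (Ioo_subset_Icc_self hc) hc.1]
  have hY'b : Y b = 0 → Y' b < 0 := by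
    intro hb
    obtain ⟨c, hc, h⟩ := exists_hasDerivAt_eq_slope Y Y' hab hYcont
      (fun x hx => hY x (Ioo_subset_Icc_self hx))
    have h1 : Y' c = 0 := by rw [h, hYa, hb]; simp
    linarith [hanti (Ioo_subset_Icc_self hc) hbI hc.2]
  have hR : ∀ i, z i ∈ Ioc a b →
      0 < √(Ω (z i)) * Y (z i) * Real.sin (t i) + Y' (z i) * Real.cos (t i) := by
    intro i hi
    have hw : 0 < √(Ω (z i)) := Real.sqrt_pos.2 (hΩpos _ (Ioc_subset_Icc_self hi))
    have key : (√(Ω (z i)) * Y (z i) * Real.sin (t i) + Y' (z i) * Real.cos (t i)) *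
        Real.sin (t i) = √(Ω (z i)) * Y (z i) := by
      linear_combination √(Ω (z i)) * Y (z i) * Real.sin_sq_add_cos_sq (t i) -
        Real.cos (t i) * ht i
    have hs : 0 ≤ Real.sin (t i) := Real.sin_nonneg_of_nonneg_of_le_pi (ht0 i).le (htpi i)
    by_cases hYz : Y (z i) = 0
    · have hzb : z i = b := by
        by_contra hzb
        exact (hYpos _ ⟨hi.1, lt_of_le_of_ne hi.2 hzb⟩).ne' hYz
      have hneg : Y' (z i) < 0 := by rw [hzb] at hYz ⊢; exact hY'b hYz
      have hsin : Real.sin (t i) = 0 := by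
        have h := ht i
        rw [hYz] at h
        simpa [hneg.ne] using h.symm
      have htp : t i = π := by
        rcases (htpi i).lt_or_eq with h | h
        · exact absurd hsin (Real.sin_pos_of_pos_of_lt_pi (ht0 i) h).ne'
        · exact h
      rw [hYz, htp]
      simpa using hneg
    · have hYz' : 0 < Y (z i) := by
        rcases hi.2.lt_or_eq with h | h
        · exact hYpos _ ⟨hi.1, h⟩
        · rw [h] at hYz ⊢; exact lt_of_le_of_ne hYb (Ne.symm hYz)
      have : 0 < √(Ω (z i)) * Y (z i) := mul_pos hw hYz'
      rw [← key] at this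
      exact pos_of_mul_pos_left this hs
  have hmem : ∀ i, z i ∈ Ioc a b := by
    intro i
    induction i with
    | zero => exact hz0
    | succ i ih =>
      have hsub : Icc a (z i) ⊆ Icc a b := Icc_subset_Icc_right ih.2
      have h := le_sub_phase_div ih.1 (hΩmono.mono hsub) (fun x hx => hΩpos x (hsub hx))
        (fun x hx => hY x (hsub hx)) (fun x hx => hY' x (hsub hx)) hYa
        (fun x hx => hYpos x ⟨hx.1, hx.2.trans_le ih.2⟩) (htpi i) (ht i) (hR i ih)
      rw [← hz i] at h
      refine ⟨lt_of_le_of_ne h (hne _).symm, ?_⟩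
      have : 0 ≤ t i / √(Ω (z i)) := div_nonneg (ht0 i).le (Real.sqrt_nonneg _)
      linarith [hz i, ih.2]
  have hmemI : ∀ i, z i ∈ Icc a b := fun i => Ioc_subset_Icc_self (hmem i)
  have hwpos : ∀ i, 0 < √(Ω (z i)) := fun i => Real.sqrt_pos.2 (hΩpos _ (hmemI i))
  have hstep : ∀ i, z (i + 1) < z i := fun i => by
    linarith [hz i, div_pos (ht0 i) (hwpos i)]
  have hzanti : StrictAnti z := strictAnti_nat_of_succ_lt hstep
  have ht_eq : ∀ i, t i = √(Ω (z i)) * (z i - z (i + 1)) := fun i => by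
    rw [hz i]
    have := (hwpos i).ne'
    field_simp
    ring
  have hcomp : ∀ {f : ℝ → ℝ} {c : ℝ}, ContinuousOn f (Icc a b) → c ∈ Icc a b →
      Tendsto z atTop (nhds c) → Tendsto (fun i => f (z i)) atTop (nhds (f c)) := by
    intro f c hf hc hzc
    exact (hf c hc).tendsto.comp
      (tendsto_nhdsWithin_iff.2 ⟨hzc, Eventually.of_forall hmemI⟩)
  have ht_lim : ∀ {c : ℝ}, c ∈ Icc a b → Tendsto z atTop (nhds c) →
      Tendsto t atTop (nhds 0) := by
    intro c hc hzc
    have h := (hcomp hΩcont hc hzc).sqrt.mul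
      (hzc.sub (hzc.comp (tendsto_add_atTop_nat 1)))
    rw [sub_self, mul_zero] at h
    exact h.congr fun i => (ht_eq i).symm
  have hza : Tendsto z atTop (nhds a) := by
    have hbdd : BddBelow (Set.range z) := ⟨a, by rintro _ ⟨i, rfl⟩; exact (hmem i).1.le⟩
    have hlim := tendsto_atTop_ciInf hzanti.antitone hbdd
    generalize (⨅ i, z i) = c at hlim
    have hac : a ≤ c := ge_of_tendsto' hlim fun i => (hmem i).1.le
    have hcb : c < b := ((hzanti.antitone.le_of_tendsto hlim 1).trans_lt (hstep 0)).trans_le hz0.2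
    have hcI : c ∈ Icc a b := ⟨hac, hcb.le⟩
    rcases hac.eq_or_lt with rfl | hac
    · exact hlim
    · exfalso
      have htl := ht_lim hcI hlim
      have h1 := ((hcomp hΩcont hcI hlim).sqrt.mul (hcomp hYcont hcI hlim)).mul
        ((Real.continuous_cos.tendsto 0).comp htl)
      have h2 := (hcomp hY'cont hcI hlim).mul ((Real.continuous_sin.tendsto 0).comp htl)
      have h3 := tendsto_nhds_unique (h1.congr ht) h2
      simp only [Real.cos_zero, Real.sin_zero, mul_one, mul_zero] at h3
      exact (mul_pos (Real.sqrt_pos.2 (hΩpos c hcI)) (hYpos c ⟨hac, hcb⟩)).ne' h3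
  have htl := ht_lim haI hza
  have hwl := (hcomp hΩcont haI hza).sqrt
  have hwa : 0 < √(Ω a) := Real.sqrt_pos.2 (hΩpos a haI)
  have hsub : ∀ i, Icc a (z i) ⊆ Icc a b := fun i => Icc_subset_Icc_right (hmem i).2
  choose c hc hcV using fun i => exists_sineWronskian_eq (hmem i).1 (hΩpos _ (hmemI i)).le
    (fun x hx => hY x (hsub i hx)) (fun x hx => hY' x (hsub i hx)) hYa
  have hca : Tendsto c atTop (nhds a) :=
    tendsto_of_tendsto_of_tendsto_of_le_of_le tendsto_const_nhds hza
      (fun i => (hc i).1.le) (fun i => (hc i).2.le)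
  have hYslope : Tendsto (fun i => (Y (c i) - Y a) / (c i - a)) atTop (nhds (Y' a)) := by
    have h := (hasDerivAt_iff_tendsto_slope.1 (hY a haI)).comp
      (tendsto_nhdsWithin_iff.2 ⟨hca, Eventually.of_forall fun i => (hc i).1.ne'⟩)
    refine h.congr fun i => ?_
    simp [slope_def_field]
  have hΩslope := hΩ'.tendsto_div_sub hza hca fun i => (hc i).2.ne'
  have hsinc : ∀ {u : ℕ → ℝ}, Tendsto u atTop (nhds a) →
      Tendsto (fun i => √(Ω (z i)) * Real.sinc (√(Ω (z i)) * (u i - a))) atTop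
        (nhds √(Ω a)) := by
    intro u hu
    have h := hwl.mul (hu.sub_const a)
    rw [sub_self, mul_zero] at h
    have h2 := hwl.mul ((Real.continuous_sinc.tendsto 0).comp h)
    rwa [Real.sinc_zero, mul_one] at h2
  have hVlim := (((hYslope.mul (hsinc hca)).mul hΩslope).div_const 12).congr
    fun i => (hcV i).symm
  have hRlim := ((hwl.mul (hcomp hYcont haI hza)).mul
    ((Real.continuous_sin.tendsto 0).comp htl)).add
      ((hcomp hY'cont haI hza).mul ((Real.continuous_cos.tendsto 0).comp htl))
  rw [Real.sin_zero, Real.cos_zero, mul_zero, mul_one, zero_add] at hRlim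
  have hDlim := hRlim.mul (hsinc (hza.comp (tendsto_add_atTop_nat 1)))
  have hDne : Y' a * √(Ω a) ≠ 0 := (mul_pos hY'a hwa).ne'
  have hquot := hVlim.div hDlim hDne
  have hval : Y' a * √(Ω a) * Ω' / 12 / (Y' a * √(Ω a)) = Ω' / 12 := by
    field_simp
  rw [hval] at hquot
  refine hquot.congr' ?_
  filter_upwards [hDlim.eventually_ne hDne] with i hi
  simp only [Function.comp] at hi
  simp only [Pi.div_apply, Function.comp]
  rw [div_eq_iff hi, sineWronskian_eq_of_phase (hwpos i).ne' (ht i), ← hz i,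
    ← Real.mul_sinc (√(Ω (z i)) * (z (i + 1) - a))]
  ring

theorem Real.sin_arctan_eq_mul_cos_arctan (x : ℝ) :
    Real.sin (Real.arctan x) = x * Real.cos (Real.arctan x) := by
  have h := Real.tan_arctan x
  rw [Real.tan_eq_sin_div_cos, div_eq_iff (Real.cos_arctan_pos x).ne'] at h
  exact h

theorem mul_arctanJ_mem {j : ℝ} (hj : j = 1 ∨ j = -1) (x : ℝ) :
    j * arctanJ j x ∈ Ioc 0 π := by
  have h1 := Real.neg_pi_div_two_lt_arctan x
  have h2 := Real.arctan_lt_pi_div_two x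
  have hpi := Real.pi_pos
  rcases hj with rfl | rfl <;> unfold arctanJ <;> split_ifs with h
  · have := Real.arctan_pos.2 (by linarith : 0 < x)
    constructor <;> linarith
  · have := Real.arctan_le_zero.2 (by linarith : x ≤ 0)
    constructor <;> linarith
  · have := Real.arctan_lt_zero.2 (by linarith : x < 0)
    constructor <;> linarith
  · have := Real.arctan_nonneg.2 (by linarith : 0 ≤ x)
    constructor <;> linarith

theorem sin_mul_arctanJ {j : ℝ} (hj : j = 1 ∨ j = -1) (x : ℝ) :
    Real.sin (j * arctanJ j x) = j * x * Real.cos (j * arctanJ j x) := by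
  have h := Real.sin_arctan_eq_mul_cos_arctan x
  rcases hj with rfl | rfl <;> unfold arctanJ <;> split_ifs <;>
    simp [Real.sin_add, Real.cos_add, h]

/-- `Tmap` moves by a phase of `(√Ω * Y, j * Y')` divided by `√Ω`. -/
theorem exists_phase_Tmap (Ω Y : ℝ → ℝ) {j : ℝ} (hj : j = 1 ∨ j = -1) (z : ℝ) :
    ∃ t, 0 < t ∧ t ≤ π ∧ j * Tmap Ω Y j z = j * z - t / √(Ω z) ∧
      √(Ω z) * Y z * Real.cos t = j * deriv Y z * Real.sin t := by
  have hjj : j * j = 1 := by rcases hj with rfl | rfl <;> norm_num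
  unfold Tmap
  split_ifs with h
  · refine ⟨π / 2, by positivity, by linarith [Real.pi_pos], ?_, by simp [h]⟩
    have : j * (z - j * π / (2 * √(Ω z))) = j * z - j * j * (π / 2 / √(Ω z)) := by
      rw [div_div]; ring
    rw [this, hjj, one_mul]
  · obtain ⟨h0, h1⟩ := mul_arctanJ_mem hj (√(Ω z) * Y z / deriv Y z)
    refine ⟨_, h0, h1, by ring, ?_⟩
    rw [sin_mul_arctanJ hj]
    generalize Real.cos _ = C
    field_simp
    linear_combination -(√(Ω z) * Y z * C) * hjj

theorem stmt1 (a b : ℝ) (hab : a ≠ b) (Ω Y : ℝ → ℝ) (U : Set ℝ) (hUopen : IsOpen U)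
    (hUI : Set.Icc (min a b) (max a b) ⊆ U)
    (hΩsmooth : ContDiffOn ℝ 3 Ω U)
    (hΩmono : MonotoneOn Ω U ∨ AntitoneOn Ω U)
    (hΩpos : ∀ z ∈ U, 0 < Ω z)
    (hΩab : Ω a < Ω b)
    (hY1 : ∀ z ∈ U, DifferentiableAt ℝ Y z)
    (hY2 : ∀ z ∈ U, DifferentiableAt ℝ (deriv Y) z)
    (hODE : ∀ z ∈ U, deriv (deriv Y) z + Ω z * Y z = 0)
    (hYnot0 : ∃ z ∈ U, Y z ≠ 0)
    (hYa : Y a = 0)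
    (hYI : ∀ z ∈ Set.Ioo (min a b) (max a b), Y z ≠ 0)
    (j : ℝ) (hj : j = Real.sign (b - a))
    (z0 : ℝ) (hz0 : z0 ∈ Set.Ioo (min a b) (max a b) ∪ {b})
    (zseq : ℕ → ℝ) (hzseq0 : zseq 0 = z0)
    (hzrec : ∀ i, zseq (i + 1) = Tmap Ω Y j (zseq i))
    (hne : ∀ i, zseq i ≠ a) :
    Filter.Tendsto (fun i => (zseq (i + 1) - a) / (zseq i - a) ^ 4)
      Filter.atTop (nhds (deriv Ω a / 12)) := by
  have hj1 : j = 1 ∨ j = -1 := by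
    rcases hab.lt_or_gt with h | h
    · left; rw [hj, Real.sign_of_pos (by linarith)]
    · right; rw [hj, Real.sign_of_neg (by linarith)]
  have hjj : j * j = 1 := by rcases hj1 with rfl | rfl <;> norm_num
  have hjab : j * a < j * b := by
    rcases hab.lt_or_gt with h | h
    · rw [hj, Real.sign_of_pos (by linarith)]; linarith
    · rw [hj, Real.sign_of_neg (by linarith)]; linarith
  have hIcc : ∀ x ∈ Icc (j * a) (j * b), j * x ∈ Icc (min a b) (max a b) := by
    rintro x ⟨hx1, hx2⟩
    rcases hj1 with rfl | rfl
    · exact ⟨min_le_iff.2 (Or.inl (by linarith)), le_max_iff.2 (Or.inr (by linarith))⟩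
    · exact ⟨min_le_iff.2 (Or.inr (by linarith)), le_max_iff.2 (Or.inl (by linarith))⟩
  have hIoo : ∀ x ∈ Ioo (j * a) (j * b), j * x ∈ Ioo (min a b) (max a b) := by
    rintro x ⟨hx1, hx2⟩
    rcases hj1 with rfl | rfl
    · exact ⟨min_lt_iff.2 (Or.inl (by linarith)), lt_max_iff.2 (Or.inr (by linarith))⟩
    · exact ⟨min_lt_iff.2 (Or.inr (by linarith)), lt_max_iff.2 (Or.inl (by linarith))⟩
  have hU : ∀ x ∈ Icc (j * a) (j * b), j * x ∈ U := fun x hx => hUI (hIcc x hx)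
  have hcancel : ∀ x, j * (j * x) = x := fun x => by rw [← mul_assoc, hjj, one_mul]
  have haU : a ∈ U := hUI ⟨min_le_left _ _, le_max_left _ _⟩
  have hbU : b ∈ U := hUI ⟨min_le_right _ _, le_max_right _ _⟩
  have hlin : ∀ x : ℝ, HasStrictDerivAt (fun x => j * x) j x := fun x => by
    simpa using (hasStrictDerivAt_id x).const_mul j
  obtain ⟨s, hs, hspos⟩ : ∃ s : ℝ, s ≠ 0 ∧ ∀ x ∈ Ioo (min a b) (max a b), 0 < s * Y x := by
    have hcont : ContinuousOn Y (Ioo (min a b) (max a b)) := fun x hx =>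
      (hY1 x (hUI (Ioo_subset_Icc_self hx))).continuousAt.continuousWithinAt
    obtain ⟨m, hm⟩ : (Ioo (min a b) (max a b)).Nonempty :=
      nonempty_Ioo.2 (min_lt_max.2 hab)
    refine ⟨Y m, hYI m hm, fun x hx => ?_⟩
    by_contra! hneg
    have himg := isPreconnected_Ioo.image Y hcont
    have h0 : (0 : ℝ) ∈ Y '' Ioo (min a b) (max a b) := by
      have hxm := mul_nonpos_iff.1 hneg
      rcases hxm with ⟨h1, h2⟩ | ⟨h1, h2⟩
      · exact himg.ordConnected.out (mem_image_of_mem Y hx) (mem_image_of_mem Y hm) ⟨h2, h1⟩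
      · exact himg.ordConnected.out (mem_image_of_mem Y hm) (mem_image_of_mem Y hx) ⟨h1, h2⟩
    obtain ⟨y, hy, hy0⟩ := h0
    exact hYI y hy hy0
  choose t ht0 htpi htz ht using fun i => exists_phase_Tmap Ω Y hj1 (zseq i)
  have hΩstrict : HasStrictDerivAt Ω (deriv Ω a) (j * (j * a)) := by
    rw [hcancel]
    exact (hΩsmooth.contDiffAt (hUopen.mem_nhds haU)).hasStrictDerivAt (by norm_num)
  have main := tendsto_phase_iteration (Ω := fun x => Ω (j * x)) (Y := fun x => s * Y (j * x))
    (Y' := fun x => s * (deriv Y (j * x) * j)) (Ω' := deriv Ω a * j) (z := fun i => j * zseq i)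
    (t := t) hjab (hΩstrict.comp (j * a) (hlin _))
    (hΩsmooth.continuousOn.comp (by fun_prop) hU)
    (by
      intro x hx y hy hxy
      rcases hab.lt_or_gt with h | h
      · have hj' : j = 1 := by rw [hj, Real.sign_of_pos (by linarith)]
        have hm : MonotoneOn Ω U := hΩmono.resolve_right fun hA =>
          absurd (hA haU hbU h.le) (not_le.2 hΩab)
        exact hm (hU x hx) (hU y hy) (by rw [hj']; linarith)
      · have hj' : j = -1 := by rw [hj, Real.sign_of_neg (by linarith)]
        have hm : AntitoneOn Ω U := hΩmono.resolve_left fun hM =>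
          absurd (hM hbU haU h.le) (not_le.2 hΩab)
        exact hm (hU y hy) (hU x hx) (by rw [hj']; linarith))
    (fun x hx => hΩpos _ (hU x hx))
    (fun x hx => (((hY1 _ (hU x hx)).hasDerivAt.comp x (hlin x).hasDerivAt).const_mul s))
    (fun x hx => by
      refine ((((hY2 _ (hU x hx)).hasDerivAt.comp x (hlin x).hasDerivAt).mul_const
        j).const_mul s).congr_deriv ?_
      linear_combination s * deriv (deriv Y) (j * x) * hjj + s * hODE _ (hU x hx))
    (by simp [hcancel, hYa]) (fun x hx => hspos _ (hIoo x hx))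
    (by
      rw [hzseq0]
      rcases hz0 with h | h
      · rcases hj1 with rfl | rfl
        · have hlt : a < b := by linarith
          rw [min_eq_left hlt.le, max_eq_right hlt.le] at h
          constructor <;> linarith [h.1, h.2]
        · have hlt : b < a := by linarith
          rw [min_eq_right hlt.le, max_eq_left hlt.le] at h
          constructor <;> linarith [h.1, h.2]
      · rw [mem_singleton_iff.1 h]
        exact ⟨hjab, le_rfl⟩)
    (fun i => by simp only [hcancel, hzrec i, htz i]) ht0 htpi
    (fun i => by
      simp only [hcancel]
      linear_combination s * ht i)
    (fun i h => hne i (by rw [← hcancel (zseq i), h, hcancel]))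
  have main' := main.const_mul j
  have hval : j * (deriv Ω a * j / 12) = deriv Ω a / 12 := by
    linear_combination deriv Ω a / 12 * hjj
  rw [hval] at main'
  refine main'.congr fun i => ?_
  have h4 : (j * zseq i - j * a) ^ 4 = (zseq i - a) ^ 4 := by
    linear_combination (zseq i - a) ^ 4 * (j * j + 1) * hjj
  rw [h4, ← mul_div_assoc]
  congr 1
  linear_combination (zseq (i + 1) - a) * hjj
end

section
/- Let n ∈ ℕ and α, β > −1 be real, let Ỹ(x) = (1−x)^((α+1)/2)·(1+x)^((β+1)/2)·P_n^{(α,β)}(x) on (−1,1), and fix x ∈ (−1,1). (i) If neither α nor β is an odd positive integer, then limsup_{j→∞} |Ỹ^{(j)}(x)/j!|^{1/j} = 1/min{1−x, 1+x}; that is, the radius of convergence of the Taylor series of Ỹ at x equals min{1−x, 1+x}. (ii) If α is an odd positive integer and β is not, then limsup_{j→∞} |Ỹ^{(j)}(x)/j!|^{1/j} = 1/(1+x); that is, the radius of convergence of the Taylor series of Ỹ at x equals 1+x. -/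
open Real Filter Set

/-- Generalized binomial coefficient `C(t, k) = t(t-1)⋯(t-k+1)/k!`. -/
noncomputable def genBinom (t : ℝ) (k : ℕ) : ℝ :=
  (∏ i ∈ Finset.range k, (t - i)) / (Nat.factorial k)

/-- The Jacobi polynomial `P_n^{(α,β)}(x)`. -/
noncomputable def jacobiP (n : ℕ) (α β : ℝ) (x : ℝ) : ℝ :=
  ∑ m ∈ Finset.range (n + 1),
    genBinom (n + α) m * genBinom (n + β) (n - m) * ((x - 1) / 2) ^ (n - m) * ((x + 1) / 2) ^ m

open Topology Polynomial

theorem AnalyticAt.rpow_const_of_pos {f : ℝ → ℝ} {x : ℝ} (hf : AnalyticAt ℝ f x) (hx : 0 < f x)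
    (a : ℝ) : AnalyticAt ℝ (fun t => f t ^ a) x := by
  have h : AnalyticAt ℝ (fun t => Real.exp (Real.log (f t) * a)) x :=
    ((hf.log hx).mul analyticAt_const).rexp'
  refine h.congr ?_
  filter_upwards [hf.continuousAt.eventually (lt_mem_nhds hx)] with t ht
  rw [Real.rpow_def_of_pos ht]

/-- A non-integer power times a nonvanishing analytic function has no analytic extension
to the branch point. -/
theorem AnalyticAt.false_of_eq_rpow_mul {a : ℝ} (ha : ∀ k : ℕ, a ≠ k) {g h : ℝ → ℝ}
    (hg : AnalyticAt ℝ g 0) (hh : AnalyticAt ℝ h 0) (h0 : h 0 ≠ 0)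
    (heq : ∀ᶠ t in 𝓝[>] (0 : ℝ), g t = t ^ a * h t) : False := by
  have hne : ∀ᶠ t in 𝓝[>] (0 : ℝ), h t ≠ 0 :=
    (hh.continuousAt.eventually_ne h0).filter_mono nhdsWithin_le_nhds
  have hpos : ∀ᶠ t in 𝓝[>] (0 : ℝ), 0 < t := self_mem_nhdsWithin
  have hgne : ¬ ∀ᶠ t in 𝓝 (0 : ℝ), g t = 0 := by
    intro hz
    obtain ⟨t, h1, h2, h3, h4⟩ :=
      ((hz.filter_mono nhdsWithin_le_nhds).and (heq.and (hne.and hpos))).exists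
    rw [h1] at h2
    exact mul_ne_zero (Real.rpow_pos_of_pos h4 a).ne' h3 h2.symm
  obtain ⟨n, k, hk, hk0, hgk⟩ := hg.exists_eventuallyEq_pow_smul_nonzero_iff.mpr hgne
  have hrel : ∀ᶠ t in 𝓝[>] (0 : ℝ), k t = t ^ (a - n) * h t := by
    filter_upwards [hgk.filter_mono nhdsWithin_le_nhds, heq, hpos] with t h1 h2 h3
    rw [h2, sub_zero, smul_eq_mul] at h1
    rw [Real.rpow_sub h3, Real.rpow_natCast]
    field_simp
    linarith
  have hkt : Tendsto k (𝓝[>] 0) (𝓝 (k 0)) := hk.continuousAt.mono_left nhdsWithin_le_nhds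
  have hht : Tendsto h (𝓝[>] 0) (𝓝 (h 0)) := hh.continuousAt.mono_left nhdsWithin_le_nhds
  have hpow : ∀ b : ℝ, 0 < b → Tendsto (fun t : ℝ => t ^ b) (𝓝[>] 0) (𝓝 0) := by
    intro b hb
    have := (Real.continuousAt_rpow_const 0 b (Or.inr hb.le)).tendsto
    rw [Real.zero_rpow hb.ne'] at this
    exact this.mono_left nhdsWithin_le_nhds
  rcases lt_or_gt_of_ne (ha n) with hlt | hgt
  · have h1 : Tendsto (fun t => t ^ ((n : ℝ) - a) * k t) (𝓝[>] 0) (𝓝 (0 * k 0)) :=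
      (hpow _ (sub_pos.mpr hlt)).mul hkt
    have h2 : Tendsto (fun t => t ^ ((n : ℝ) - a) * k t) (𝓝[>] 0) (𝓝 (h 0)) := by
      refine hht.congr' ?_
      filter_upwards [hrel, hpos] with t h3 h4
      rw [h3, ← mul_assoc, ← Real.rpow_add h4]
      simp
    exact h0 (by simpa using tendsto_nhds_unique h2 h1)
  · have h1 : Tendsto (fun t => t ^ (a - n) * h t) (𝓝[>] 0) (𝓝 (0 * h 0)) :=
      (hpow _ (sub_pos.mpr hgt)).mul hht
    have h2 := tendsto_nhds_unique hkt (h1.congr' (hrel.mono fun t ht => ht.symm))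
    exact hk0 (by simpa using h2)

/-- Geometric bounds on the Taylor coefficients at a point extend the function analytically. -/
theorem AnalyticOnNhd.exists_extension_of_iteratedDeriv_le {Y : ℝ → ℝ} {x s a b : ℝ}
    (hY : AnalyticOnNhd ℝ Y (Ioo a b)) (hx : x ∈ Ioo a b) (hs : 0 < s)
    (h : ∀ᶠ j : ℕ in atTop, |iteratedDeriv j Y x| / (Nat.factorial j) ≤ s ^ j) :
    ∃ g : ℝ → ℝ, AnalyticOnNhd ℝ g (Metric.ball x (1 / s)) ∧
      EqOn g Y (Metric.ball x (1 / s) ∩ Ioo a b) := by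
  set p := FormalMultilinearSeries.ofScalars ℝ
    (fun n ↦ iteratedDeriv n Y x / (n.factorial : ℝ)) with hp
  have hYp : HasFPowerSeriesAt Y p x := (hY x hx).hasFPowerSeriesAt
  have hR : (((1 / s).toNNReal : NNReal) : ENNReal) ≤ p.radius := by
    refine p.le_radius_of_eventually_le 1 ?_
    filter_upwards [h] with j hj
    rw [hp, FormalMultilinearSeries.ofScalars_norm, Real.coe_toNNReal _ (by positivity),
      norm_div, Real.norm_eq_abs, RCLike.norm_natCast]
    calc _ ≤ s ^ j * (1 / s) ^ j := by gcongr
      _ = 1 := by rw [← mul_pow, mul_one_div_cancel hs.ne', one_pow]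
  have hball := (p.hasFPowerSeriesOnBall hYp.radius_pos).comp_sub x
  rw [zero_add] at hball
  have hgan : AnalyticOnNhd ℝ (fun t => p.sum (t - x)) (Metric.ball x (1 / s)) := by
    refine hball.analyticOnNhd.mono ?_
    rw [← Metric.eball_ofReal]
    exact Metric.eball_subset_eball hR
  refine ⟨_, hgan, ?_⟩
  have hxb : x ∈ Metric.ball x (1 / s) := Metric.mem_ball_self (by positivity)
  refine (hgan.mono inter_subset_left).eqOn_of_preconnected_of_eventuallyEq
    (hY.mono inter_subset_right) ?_ ⟨hxb, hx⟩ ?_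
  · rw [Real.ball_eq_Ioo]
    exact (ordConnected_Ioo.inter ordConnected_Ioo).isPreconnected
  · filter_upwards [hYp.eventually_hasSum_sub, hball.hasFPowerSeriesAt.eventually_hasSum_sub]
      with t h1 h2
    exact h2.unique h1

theorem eventually_iteratedDeriv_eq_re {F : ℂ → ℂ} {Y : ℝ → ℝ} {x r : ℝ} (hr : 0 < r)
    (hF : DifferentiableOn ℂ F (Metric.ball (x : ℂ) r))
    (hFY : ∀ᶠ t : ℝ in 𝓝 x, Y t = (F t).re) (j : ℕ) :
    ∀ᶠ t : ℝ in 𝓝 x, iteratedDeriv j Y t = (iteratedDeriv j F t).re := by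
  induction j with
  | zero => simpa using hFY
  | succ j ih =>
    filter_upwards [ih.eventually_nhds, Metric.ball_mem_nhds x hr] with t ht htr
    have htr' : (t : ℂ) ∈ Metric.ball (x : ℂ) r := by
      simpa [Complex.dist_eq, ← Complex.ofReal_sub, Real.dist_eq] using htr
    have hd : DifferentiableAt ℂ (iteratedDeriv j F) t := by
      rw [iteratedDeriv_eq_iterate]
      exact ((hF.analyticOnNhd Metric.isOpen_ball).iterated_deriv j _ htr').differentiableAt
    rw [iteratedDeriv_succ, iteratedDeriv_succ]
    exact (hd.hasDerivAt.real_of_complex.congr_of_eventuallyEq ht).deriv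

theorem exists_iteratedDeriv_mul_pow_le {F : ℂ → ℂ} {Y : ℝ → ℝ} {x r s : ℝ}
    (hF : DifferentiableOn ℂ F (Metric.ball (x : ℂ) r))
    (hFY : ∀ᶠ t : ℝ in 𝓝 x, Y t = (F t).re) (hs : 0 < s) (hsr : s < r) :
    ∃ C : ℝ, ∀ j : ℕ, |iteratedDeriv j Y x| / (Nat.factorial j) * s ^ j ≤ C := by
  have hsub : Metric.closedBall (x : ℂ) s ⊆ Metric.ball (x : ℂ) r :=
    Metric.closedBall_subset_ball hsr
  obtain ⟨C, hC⟩ := (isCompact_closedBall (x : ℂ) s).exists_bound_of_continuousOn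
    (hF.continuousOn.mono hsub)
  refine ⟨C, fun j => ?_⟩
  have h1 := Complex.norm_iteratedDeriv_le_of_forall_mem_sphere_norm_le j hs
    ((hF.mono hsub).diffContOnCl_ball subset_rfl)
    (fun z hz => hC z (Metric.sphere_subset_closedBall hz))
  have h2 : |iteratedDeriv j Y x| ≤ ‖iteratedDeriv j F x‖ := by
    rw [(eventually_iteratedDeriv_eq_re (hs.trans hsr) hF hFY j).self_of_nhds]
    exact Complex.abs_re_le_norm _
  have h3 := h2.trans h1
  rw [le_div_iff₀ (by positivity)] at h3
  rw [div_mul_eq_mul_div, div_le_iff₀ (by positivity)]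
  linarith

/-- A form of the Cauchy–Hadamard formula. -/
theorem limsup_rpow_inv_eq_one_div {c : ℕ → ℝ} {r : ℝ} (hc : ∀ j, 0 ≤ c j) (hr : 0 < r)
    (hU : ∀ s, 0 < s → s < r → ∃ C : ℝ, ∀ j, c j * s ^ j ≤ C)
    (hL : ∀ s, 0 < s → s < 1 / r → ¬ ∀ᶠ j in atTop, c j ≤ s ^ j) :
    limsup (fun j : ℕ => c j ^ ((1 : ℝ) / j)) atTop = 1 / r := by
  have hbd : ∀ b, 1 / r < b → ∀ᶠ j : ℕ in atTop, c j ^ ((1 : ℝ) / j) ≤ b := by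
    intro b hb
    have hr' : 0 < 1 / r := by positivity
    obtain ⟨m, hm1, hm2⟩ := exists_between hb
    have hm0 := hr'.trans hm1
    obtain ⟨C, hC⟩ := hU (1 / m) (by positivity) ((one_div_lt hm0 hr).mpr hm1)
    have hD : 0 < max C 1 := by positivity
    have hlim : Tendsto (fun j : ℕ => max C 1 ^ ((1 : ℝ) / j) * m) atTop (𝓝 (1 * m)) := by
      refine Tendsto.mul_const m ?_
      have := (Real.continuousAt_const_rpow hD.ne').tendsto.comp
        (tendsto_const_div_atTop_nhds_zero_nat (1 : ℝ))
      simpa [Function.comp_def] using this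
    rw [one_mul] at hlim
    filter_upwards [hlim.eventually (gt_mem_nhds hm2), eventually_gt_atTop 0] with j hj hj0
    refine le_trans ?_ hj.le
    have h1 : c j ≤ max C 1 * m ^ j := by
      have := (hC j).trans (le_max_left C 1)
      rwa [one_div, inv_pow, ← div_eq_mul_inv, div_le_iff₀ (by positivity)] at this
    calc c j ^ ((1 : ℝ) / j) ≤ (max C 1 * m ^ j) ^ ((1 : ℝ) / j) :=
          Real.rpow_le_rpow (hc j) h1 (by positivity)
      _ = max C 1 ^ ((1 : ℝ) / j) * m := by
          rw [Real.mul_rpow hD.le (by positivity), one_div,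
            Real.pow_rpow_inv_natCast hm0.le hj0.ne']
  have hnn : ∀ j : ℕ, 0 ≤ c j ^ ((1 : ℝ) / j) := fun j => Real.rpow_nonneg (hc j) _
  have hbelow : IsBoundedUnder (· ≥ ·) atTop (fun j : ℕ => c j ^ ((1 : ℝ) / j)) :=
    isBoundedUnder_of ⟨0, hnn⟩
  have habove : IsBoundedUnder (· ≤ ·) atTop (fun j : ℕ => c j ^ ((1 : ℝ) / j)) :=
    ⟨1 / r + 1, by simpa using hbd (1 / r + 1) (by linarith)⟩
  refine le_antisymm ?_ ?_
  · refine le_of_forall_gt_imp_ge_of_dense fun b hb => ?_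
    exact limsup_le_of_le hbelow.isCoboundedUnder_le (hbd b hb)
  · by_contra! hlt
    obtain ⟨s, hs1, hs2⟩ := exists_between (max_lt hlt (show 0 < 1 / r by positivity))
    have hs0 : 0 < s := (le_max_right _ _).trans_lt hs1
    refine hL s hs0 hs2 ?_
    filter_upwards [eventually_lt_of_limsup_lt ((le_max_left _ _).trans_lt hs1) habove,
      eventually_gt_atTop 0] with j hj hj0
    calc c j = (c j ^ ((1 : ℝ) / j)) ^ j := by
          rw [one_div, Real.rpow_inv_natCast_pow (hc j) hj0.ne']
      _ ≤ s ^ j := pow_le_pow_left₀ (hnn j) hj.le j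

/-- If `Y` is locally the real part of a function holomorphic on the disc of radius `r`, and has
no analytic extension to a larger interval, then its Taylor series has radius `r`. -/
theorem limsup_iteratedDeriv_eq_one_div {F : ℂ → ℂ} {Y : ℝ → ℝ} {x r a b : ℝ} (hr : 0 < r)
    (hF : DifferentiableOn ℂ F (Metric.ball (x : ℂ) r))
    (hFY : ∀ᶠ t : ℝ in 𝓝 x, Y t = (F t).re)
    (hY : AnalyticOnNhd ℝ Y (Ioo a b)) (hx : x ∈ Ioo a b)
    (hsing : ∀ R, r < R → ∀ g : ℝ → ℝ, AnalyticOnNhd ℝ g (Metric.ball x R) →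
      ¬ EqOn g Y (Metric.ball x R ∩ Ioo a b)) :
    limsup (fun j : ℕ => (|iteratedDeriv j Y x| / (Nat.factorial j)) ^ ((1 : ℝ) / j))
      atTop = 1 / r := by
  refine limsup_rpow_inv_eq_one_div (c := fun j => |iteratedDeriv j Y x| / (Nat.factorial j))
    (fun j => by positivity) hr
    (fun s hs hsr => exists_iteratedDeriv_mul_pow_le hF hFY hs hsr) fun s hs hsr h => ?_
  obtain ⟨g, hg, hgY⟩ := hY.exists_extension_of_iteratedDeriv_le hx hs h
  exact hsing _ ((lt_one_div hs hr).mp hsr) g hg hgY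

theorem genBinom_natCast_add_ne_zero (n : ℕ) {α : ℝ} (hα : -1 < α) : genBinom (n + α) n ≠ 0 := by
  refine div_ne_zero (Finset.prod_ne_zero_iff.mpr fun i hi => ?_) (by positivity)
  have : (i : ℝ) + 1 ≤ n := by exact_mod_cast Finset.mem_range.mp hi
  linarith

theorem genBinom_zero (t : ℝ) : genBinom t 0 = 1 := by simp [genBinom]

theorem jacobiP_one_ne_zero (n : ℕ) {α : ℝ} (β : ℝ) (hα : -1 < α) : jacobiP n α β 1 ≠ 0 := by
  have : jacobiP n α β 1 = genBinom (n + α) n := by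
    rw [jacobiP, Finset.sum_eq_single_of_mem n (by simp)]
    · norm_num [genBinom_zero]
    · intro m hm hmn
      have : n - m ≠ 0 := by have := Finset.mem_range.mp hm; omega
      simp [this]
  rw [this]
  exact genBinom_natCast_add_ne_zero n hα

theorem jacobiP_neg_one_ne_zero (n : ℕ) (α : ℝ) {β : ℝ} (hβ : -1 < β) :
    jacobiP n α β (-1) ≠ 0 := by
  have : jacobiP n α β (-1) = genBinom (n + β) n * (-1) ^ n := by
    rw [jacobiP, Finset.sum_eq_single_of_mem 0 (by simp)]
    · norm_num [genBinom_zero]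
    · intro m _ hm
      simp [hm]
  rw [this]
  exact mul_ne_zero (genBinom_natCast_add_ne_zero n hβ) (by simp)

theorem exists_polynomial_eval_eq_jacobiP (n : ℕ) (α β : ℝ) :
    ∃ Q : ℝ[X], ∀ t, jacobiP n α β t = Q.eval t := by
  refine ⟨∑ m ∈ Finset.range (n + 1), C (genBinom (n + α) m) * C (genBinom (n + β) (n - m)) *
    (C (1 / 2) * (X - C 1)) ^ (n - m) * (C (1 / 2) * (X + C 1)) ^ m, fun t => ?_⟩
  rw [jacobiP, eval_finsetSum]
  refine Finset.sum_congr rfl fun m _ => ?_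
  simp only [eval_mul, eval_C, eval_pow, eval_sub, eval_add, eval_X]
  ring

theorem analyticAt_jacobiP (n : ℕ) (α β t : ℝ) : AnalyticAt ℝ (jacobiP n α β) t := by
  obtain ⟨Q, hQ⟩ := exists_polynomial_eval_eq_jacobiP n α β
  rw [funext hQ]
  exact AnalyticOnNhd.eval_polynomial Q t (mem_univ t)

section WeightedJacobi

variable {n : ℕ} {α β a b : ℝ} {Y : ℝ → ℝ}

theorem analyticOnNhd_of_eq_rpow_mul_rpow_mul_jacobiP
    (hY : ∀ x ∈ Ioo (-1 : ℝ) 1, Y x = (1 - x) ^ a * (1 + x) ^ b * jacobiP n α β x) :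
    AnalyticOnNhd ℝ Y (Ioo (-1) 1) := by
  intro t ht
  have h1 : AnalyticAt ℝ (fun t : ℝ => 1 - t) t := analyticAt_const.sub analyticAt_id
  have h2 : AnalyticAt ℝ (fun t : ℝ => 1 + t) t := analyticAt_const.add analyticAt_id
  refine (((h1.rpow_const_of_pos (by linarith [ht.2]) a).mul
    (h2.rpow_const_of_pos (by linarith [ht.1]) b)).mul (analyticAt_jacobiP n α β t)).congr ?_
  filter_upwards [isOpen_Ioo.mem_nhds ht] with u hu
  exact (hY u hu).symm

theorem not_eqOn_of_analyticAt_one (hα : -1 < α) (ha : ∀ k : ℕ, a ≠ k)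
    (hY : ∀ x ∈ Ioo (-1 : ℝ) 1, Y x = (1 - x) ^ a * (1 + x) ^ b * jacobiP n α β x)
    {g : ℝ → ℝ} {x R : ℝ} (hx : x < 1) (hR : 1 - x < R)
    (hg : AnalyticOnNhd ℝ g (Metric.ball x R)) : ¬ EqOn g Y (Metric.ball x R ∩ Ioo (-1) 1) := by
  intro hgY
  have hmem : (1 : ℝ) ∈ Metric.ball x R := by
    rwa [Metric.mem_ball, Real.dist_eq, abs_of_pos (by linarith)]
  have hs : AnalyticAt ℝ (fun t : ℝ => 1 - t) 0 := analyticAt_const.sub analyticAt_id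
  have hs2 : AnalyticAt ℝ (fun t : ℝ => 2 - t) 0 := analyticAt_const.sub analyticAt_id
  have hg0 : AnalyticAt ℝ (fun t => g (1 - t)) 0 :=
    AnalyticAt.fun_comp (by simpa using hg 1 hmem) hs
  have hh : AnalyticAt ℝ (fun t => (2 - t) ^ b * jacobiP n α β (1 - t)) 0 :=
    (hs2.rpow_const_of_pos (by norm_num) b).mul
      (AnalyticAt.fun_comp (analyticAt_jacobiP n α β _) hs)
  refine hg0.false_of_eq_rpow_mul ha hh ?_ ?_
  · simpa using ⟨(Real.rpow_pos_of_pos two_pos b).ne', jacobiP_one_ne_zero n β hα⟩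
  · have h1 : ∀ᶠ t in 𝓝 (0 : ℝ), 1 - t ∈ Metric.ball x R :=
      hs.continuousAt.eventually (Metric.isOpen_ball.mem_nhds (by simpa using hmem))
    filter_upwards [h1.filter_mono nhdsWithin_le_nhds, self_mem_nhdsWithin,
      (gt_mem_nhds (show (0 : ℝ) < 2 by norm_num)).filter_mono nhdsWithin_le_nhds] with t h2 h3 h4
    have h5 : 1 - t ∈ Ioo (-1 : ℝ) 1 := ⟨by linarith, by simpa using h3⟩
    rw [hgY ⟨h2, h5⟩, hY _ h5]
    ring_nf

theorem not_eqOn_of_analyticAt_neg_one (hβ : -1 < β) (hb : ∀ k : ℕ, b ≠ k)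
    (hY : ∀ x ∈ Ioo (-1 : ℝ) 1, Y x = (1 - x) ^ a * (1 + x) ^ b * jacobiP n α β x)
    {g : ℝ → ℝ} {x R : ℝ} (hx : -1 < x) (hR : 1 + x < R)
    (hg : AnalyticOnNhd ℝ g (Metric.ball x R)) : ¬ EqOn g Y (Metric.ball x R ∩ Ioo (-1) 1) := by
  intro hgY
  have hmem : (-1 : ℝ) ∈ Metric.ball x R := by
    rw [Metric.mem_ball, Real.dist_eq, abs_of_neg (by linarith)]
    linarith
  have hs : AnalyticAt ℝ (fun t : ℝ => -1 + t) 0 := analyticAt_const.add analyticAt_id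
  have hs2 : AnalyticAt ℝ (fun t : ℝ => 2 - t) 0 := analyticAt_const.sub analyticAt_id
  have hg0 : AnalyticAt ℝ (fun t => g (-1 + t)) 0 :=
    AnalyticAt.fun_comp (by simpa using hg (-1) hmem) hs
  have hh : AnalyticAt ℝ (fun t => (2 - t) ^ a * jacobiP n α β (-1 + t)) 0 :=
    (hs2.rpow_const_of_pos (by norm_num) a).mul
      (AnalyticAt.fun_comp (analyticAt_jacobiP n α β _) hs)
  refine hg0.false_of_eq_rpow_mul hb hh ?_ ?_
  · simpa using ⟨(Real.rpow_pos_of_pos two_pos a).ne', jacobiP_neg_one_ne_zero n α hβ⟩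
  · have h1 : ∀ᶠ t in 𝓝 (0 : ℝ), -1 + t ∈ Metric.ball x R :=
      hs.continuousAt.eventually (Metric.isOpen_ball.mem_nhds (by simpa using hmem))
    filter_upwards [h1.filter_mono nhdsWithin_le_nhds, self_mem_nhdsWithin,
      (gt_mem_nhds (show (0 : ℝ) < 2 by norm_num)).filter_mono nhdsWithin_le_nhds] with t h2 h3 h4
    have h5 : -1 + t ∈ Ioo (-1 : ℝ) 1 := ⟨by simpa using h3, by linarith⟩
    rw [hgY ⟨h2, h5⟩, hY _ h5]
    ring_nf

end WeightedJacobi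

theorem one_add_mem_slitPlane_of_mem_ball {x r : ℝ} {z : ℂ} (hz : z ∈ Metric.ball (x : ℂ) r)
    (hr : r ≤ 1 + x) : 1 + z ∈ Complex.slitPlane := by
  have h1 := (Complex.abs_re_le_norm (z - x)).trans_lt (mem_ball_iff_norm.mp hz)
  refine Or.inl ?_
  simp only [Complex.sub_re, Complex.ofReal_re] at h1
  simp only [Complex.add_re, Complex.one_re]
  linarith [(abs_lt.mp h1).1]

theorem one_sub_mem_slitPlane_of_mem_ball {x r : ℝ} {z : ℂ} (hz : z ∈ Metric.ball (x : ℂ) r)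
    (hr : r ≤ 1 - x) : 1 - z ∈ Complex.slitPlane := by
  have h1 := (Complex.abs_re_le_norm (z - x)).trans_lt (mem_ball_iff_norm.mp hz)
  refine Or.inl ?_
  simp only [Complex.sub_re, Complex.ofReal_re] at h1
  simp only [Complex.sub_re, Complex.one_re]
  linarith [(abs_lt.mp h1).2]

theorem ofReal_one_add_rpow {t : ℝ} (ht : t ∈ Ioo (-1 : ℝ) 1) (b : ℝ) :
    (((1 + t) ^ b : ℝ) : ℂ) = (1 + (t : ℂ)) ^ (b : ℂ) := by
  rw [Complex.ofReal_cpow (by linarith [ht.1])]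
  simp

theorem ofReal_one_sub_rpow {t : ℝ} (ht : t ∈ Ioo (-1 : ℝ) 1) (a : ℝ) :
    (((1 - t) ^ a : ℝ) : ℂ) = (1 - (t : ℂ)) ^ (a : ℂ) := by
  rw [Complex.ofReal_cpow (by linarith [ht.2])]
  simp

theorem stmt18 (n : ℕ) (α β : ℝ) (hα : -1 < α) (hβ : -1 < β)
    (Y : ℝ → ℝ)
    (hY : ∀ x ∈ Set.Ioo (-1 : ℝ) 1,
      Y x = (1 - x) ^ ((α + 1) / 2) * (1 + x) ^ ((β + 1) / 2) * jacobiP n α β x)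
    (x : ℝ) (hx : x ∈ Set.Ioo (-1 : ℝ) 1) :
    ((¬ ∃ k : ℕ, α = 2 * (k : ℝ) + 1) → (¬ ∃ k : ℕ, β = 2 * (k : ℝ) + 1) →
      Filter.limsup
        (fun j : ℕ => (|iteratedDeriv j Y x| / (Nat.factorial j)) ^ ((1 : ℝ) / j))
        Filter.atTop = 1 / min (1 - x) (1 + x)) ∧
    ((∃ k : ℕ, α = 2 * (k : ℝ) + 1) → (¬ ∃ k : ℕ, β = 2 * (k : ℝ) + 1) →
      Filter.limsup
        (fun j : ℕ => (|iteratedDeriv j Y x| / (Nat.factorial j)) ^ ((1 : ℝ) / j))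
        Filter.atTop = 1 / (1 + x)) := by
  have hYan := analyticOnNhd_of_eq_rpow_mul_rpow_mul_jacobiP hY
  obtain ⟨Q, hQ⟩ := exists_polynomial_eval_eq_jacobiP n α β
  have hev : ∀ t : ℝ, aeval (t : ℂ) Q = ((jacobiP n α β t : ℝ) : ℂ) := fun t => by
    rw [hQ, ← Complex.coe_algebraMap, aeval_algebraMap_apply, coe_aeval_eq_eval]
  have hnat : ∀ {γ : ℝ}, -1 < γ → (¬ ∃ k : ℕ, γ = 2 * (k : ℝ) + 1) →
      ∀ k : ℕ, (γ + 1) / 2 ≠ k := by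
    intro γ hγ h k hk
    rcases k with _ | k
    · norm_num at hk
      linarith
    · refine h ⟨k, ?_⟩
      push_cast at hk
      linarith
  have hnear : Ioo (-1 : ℝ) 1 ∈ 𝓝 x := isOpen_Ioo.mem_nhds hx
  refine ⟨fun h1 h2 => ?_, fun h1 h2 => ?_⟩
  · refine limsup_iteratedDeriv_eq_one_div
      (F := fun z => (1 - z) ^ (((α + 1) / 2 : ℝ) : ℂ) * (1 + z) ^ (((β + 1) / 2 : ℝ) : ℂ) *
        aeval z Q)
      (lt_min (by linarith [hx.2]) (by linarith [hx.1])) ?_ ?_ hYan hx ?_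
    · intro z hz
      refine DifferentiableAt.differentiableWithinAt ?_
      exact (((differentiableAt_id.const_sub 1).cpow_const
        (one_sub_mem_slitPlane_of_mem_ball hz (min_le_left _ _))).mul
        ((differentiableAt_id.const_add 1).cpow_const
        (one_add_mem_slitPlane_of_mem_ball hz (min_le_right _ _)))).mul Q.differentiableAt_aeval
    · filter_upwards [hnear] with t ht
      rw [hev, ← ofReal_one_add_rpow ht, ← ofReal_one_sub_rpow ht, ← Complex.ofReal_mul,
        ← Complex.ofReal_mul, Complex.ofReal_re, hY t ht]
    · intro R hR g hg
      rcases min_lt_iff.mp hR with hR | hR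
      · exact not_eqOn_of_analyticAt_one hα (hnat hα h1) hY hx.2 hR hg
      · exact not_eqOn_of_analyticAt_neg_one hβ (hnat hβ h2) hY hx.1 hR hg
  · obtain ⟨k, hk⟩ := h1
    refine limsup_iteratedDeriv_eq_one_div
      (F := fun z => (1 - z) ^ (k + 1) * (1 + z) ^ (((β + 1) / 2 : ℝ) : ℂ) * aeval z Q)
      (by linarith [hx.1]) ?_ ?_ hYan hx
      fun R hR g hg => not_eqOn_of_analyticAt_neg_one hβ (hnat hβ h2) hY hx.1 hR hg
    · intro z hz
      refine DifferentiableAt.differentiableWithinAt ?_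
      exact (((differentiableAt_id.const_sub 1).pow (k + 1)).mul
        ((differentiableAt_id.const_add 1).cpow_const
        (one_add_mem_slitPlane_of_mem_ball hz le_rfl))).mul Q.differentiableAt_aeval
    · filter_upwards [hnear] with t ht
      have hexp : (α + 1) / 2 = ((k + 1 : ℕ) : ℝ) := by
        push_cast
        linarith
      have hpow : (1 - (t : ℂ)) ^ (k + 1) = (((1 - t) ^ (k + 1) : ℝ) : ℂ) := by push_cast; rfl
      rw [hev, ← ofReal_one_add_rpow ht, hpow, ← Complex.ofReal_mul,
        ← Complex.ofReal_mul, Complex.ofReal_re, hY t ht, hexp, Real.rpow_natCast]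
end
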